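/- arXiv:2001.08778 — 2 statements merged into one kernel-verified Lean document; each statement's English description precedes it below -/
import Mathlib

section
/- Let a > 0, let C > 0 and N, M be nonnegative integers, and let (g_n) be a sequence of functions holomorphic on the strip S_a = {τ ∈ ℂ : 0 < Im τ < a}, each satisfying |g_n(x+iy)| ≤ C(1+|x|^N) y^{-M} for all x ∈ ℝ, y ∈ (0,a), with the same constants C, N, M for all n. Suppose g_n converges pointwise on S_a to a function g. Then g is holomorphic on S_a and satisfies the same slow-growth bound, and for every Schwartz function f : ℝ → ℂ one has lim_{n→∞} [lim_{y→0+} ∫_ℝ g_n(x+iy) f(x) dx] = lim_{y→0+} ∫_ℝ g(x+iy) f(x) dx, where all the inner limits exist and are finite. -/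
open MeasureTheory Filter Complex

/-- Differentiating a Taylor polynomial in its base point leaves only the top-order term. -/
theorem hasDerivAt_taylorSum_basePoint {h : ℕ → ℝ → ℂ} {t : ℝ}
    (hh : ∀ k, HasDerivAt (h k) (h (k + 1) t) t) (y : ℝ) (m : ℕ) :
    HasDerivAt (fun s => ∑ k ∈ Finset.range (m + 1), ((y - s) ^ k / k.factorial : ℝ) • h k s)
      (((y - t) ^ m / m.factorial : ℝ) • h (m + 1) t) t := by
  induction m with
  | zero => simpa using hh 0
  | succ m ih =>
    simp_rw [Finset.sum_range_succ _ (m + 1)]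
    have hpow : HasDerivAt (fun s : ℝ => (y - s) ^ (m + 1) / ((m + 1).factorial : ℝ))
        (-((y - t) ^ m / m.factorial)) t := by
      convert! (((hasDerivAt_id t).const_sub y).pow (m + 1)).div_const
        ((m + 1).factorial : ℝ) using 1
      rw [Nat.factorial_succ]
      push_cast
      simp only [id]
      field_simp
    convert! ih.add (hpow.smul (hh (m + 1))) using 1
    rw [neg_smul]
    abel

/-- The value at `0` of a function on `(0, b]` whose iterated derivatives are `h k`, computed from
the Taylor formula of order `m` at `b` with integral remainder. -/
noncomputable def boundaryValue (h : ℕ → ℝ → ℂ) (m : ℕ) (b : ℝ) : ℂ :=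
  (∑ k ∈ Finset.range (m + 1), ((0 - b) ^ k / k.factorial : ℝ) • h k b) -
    ∫ t in Set.Ioc 0 b, ((0 - t) ^ m / m.factorial : ℝ) • h (m + 1) t

theorem norm_taylor_remainder_le {z : ℂ} {m : ℕ} {y t K : ℝ} (hy : 0 ≤ y) (hyt : y < t)
    (hz : ‖z‖ ≤ K / t ^ m) : ‖((y - t) ^ m / m.factorial : ℝ) • z‖ ≤ K := by
  have ht : 0 < t := hy.trans_lt hyt
  have hfac : (1 : ℝ) ≤ m.factorial := by exact_mod_cast m.factorial_pos
  have h1 : ‖((y - t) ^ m / m.factorial : ℝ)‖ ≤ t ^ m := by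
    rw [norm_div, norm_pow, Real.norm_eq_abs, RCLike.norm_natCast]
    refine (div_le_self (by positivity) hfac).trans ?_
    refine pow_le_pow_left₀ (abs_nonneg _) ?_ _
    rw [abs_le]; constructor <;> linarith
  calc _ = ‖((y - t) ^ m / m.factorial : ℝ)‖ * ‖z‖ := norm_smul _ _
    _ ≤ t ^ m * (K / t ^ m) := by gcongr
    _ = K := by field_simp

/-- A function on `(0, b]` whose derivative of order `m + 1` is `O(t ^ (-m))` has a limit at `0`. -/
theorem tendsto_boundaryValue {h : ℕ → ℝ → ℂ} {m : ℕ} {b K : ℝ} (hb : 0 < b)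
    (hh : ∀ t ∈ Set.Ioc 0 b, ∀ k, HasDerivAt (h k) (h (k + 1) t) t)
    (hK : ∀ t ∈ Set.Ioc 0 b, ‖h (m + 1) t‖ ≤ K / t ^ m) :
    Tendsto (h 0) (nhdsWithin 0 (Set.Ioi 0)) (nhds (boundaryValue h m b)) := by
  have hcont : ContinuousOn (h (m + 1)) (Set.Ioc 0 b) := fun t ht =>
    (hh t ht (m + 1)).continuousAt.continuousWithinAt
  have hcont' (y : ℝ) : ContinuousOn
      (fun t => ((y - t) ^ m / m.factorial : ℝ) • h (m + 1) t) (Set.Ioc 0 b) :=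
    ContinuousOn.smul (f := fun t => (y - t) ^ m / m.factorial) (by fun_prop) hcont
  have hformula : ∀ y ∈ Set.Ioo 0 b,
      (∑ k ∈ Finset.range (m + 1), ((y - b) ^ k / k.factorial : ℝ) • h k b) -
        ∫ t in Set.Ioc 0 b, (Set.Ioi y).indicator
          (fun t => ((y - t) ^ m / m.factorial : ℝ) • h (m + 1) t) t = h 0 y := by
    intro y hy
    have hsub : Set.uIcc y b ⊆ Set.Ioc 0 b := by
      rw [Set.uIcc_of_le hy.2.le]
      exact fun t ht => ⟨hy.1.trans_le ht.1, ht.2⟩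
    have hftc := intervalIntegral.integral_eq_sub_of_hasDerivAt
      (fun t ht => hasDerivAt_taylorSum_basePoint (hh t (hsub ht)) y m)
      ((hcont' y).mono hsub).intervalIntegrable
    have hy0 : ∑ k ∈ Finset.range (m + 1), ((y - y) ^ k / k.factorial : ℝ) • h k y = h 0 y := by
      rw [Finset.sum_range_succ']
      simp
    rw [setIntegral_indicator measurableSet_Ioi, Set.Ioc_inter_Ioi, max_eq_right hy.1.le,
      ← intervalIntegral.integral_of_le hy.2.le, hftc, hy0]
    abel
  refine Tendsto.congr' (f₁ := fun y => (∑ k ∈ Finset.range (m + 1),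
      ((y - b) ^ k / k.factorial : ℝ) • h k b) - ∫ t in Set.Ioc 0 b, (Set.Ioi y).indicator
        (fun t => ((y - t) ^ m / m.factorial : ℝ) • h (m + 1) t) t) ?_ ?_
  · filter_upwards [Ioo_mem_nhdsGT hb] with y hy using hformula y hy
  refine Tendsto.sub (Tendsto.mono_left (Continuous.tendsto (by fun_prop) 0) nhdsWithin_le_nhds) ?_
  have hK0 : 0 ≤ K := by
    have := (norm_nonneg _).trans (hK b ⟨hb, le_rfl⟩)
    rwa [le_div_iff₀ (by positivity), zero_mul] at this
  refine tendsto_integral_filter_of_dominated_convergence (fun _ => K) ?_ ?_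
    (integrableOn_const (by simp)) ?_
  · refine Eventually.of_forall fun y => ?_
    exact ((hcont' y).aestronglyMeasurable measurableSet_Ioc).indicator measurableSet_Ioi
  · filter_upwards [self_mem_nhdsWithin] with y hy
    refine (ae_restrict_mem measurableSet_Ioc).mono fun t ht => ?_
    by_cases hyt : t ∈ Set.Ioi y
    · rw [Set.indicator_of_mem hyt]
      exact norm_taylor_remainder_le (le_of_lt hy) hyt (hK t ht)
    · simpa [Set.indicator_of_notMem hyt] using hK0
  · refine (ae_restrict_mem measurableSet_Ioc).mono fun t ht => ?_
    refine Tendsto.congr' (f₁ := fun y => ((y - t) ^ m / m.factorial : ℝ) • h (m + 1) t) ?_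
      (Tendsto.mono_left (Continuous.tendsto (by fun_prop) 0) nhdsWithin_le_nhds)
    filter_upwards [Ioo_mem_nhdsGT ht.1] with y hy
    have hyt : t ∈ Set.Ioi y := hy.2
    rw [Set.indicator_of_mem hyt]

theorem tendsto_boundaryValue_of_pointwise {H : ℕ → ℕ → ℝ → ℂ} {h : ℕ → ℝ → ℂ} {m : ℕ} {b K : ℝ}
    (hb : 0 < b) (hcont : ∀ n, ContinuousOn (H n (m + 1)) (Set.Ioc 0 b))
    (hK : ∀ n, ∀ t ∈ Set.Ioc 0 b, ‖H n (m + 1) t‖ ≤ K / t ^ m)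
    (hlim : ∀ k, ∀ t ∈ Set.Ioc 0 b, Tendsto (fun n => H n k t) atTop (nhds (h k t))) :
    Tendsto (fun n => boundaryValue (H n) m b) atTop (nhds (boundaryValue h m b)) := by
  refine Tendsto.sub (tendsto_finsetSum _ fun k _ => (hlim k b ⟨hb, le_rfl⟩).const_smul _) ?_
  refine tendsto_integral_of_dominated_convergence (fun _ => K) (fun n => ?_)
    (integrableOn_const (by simp)) (fun n => ?_) ?_
  · have hw : Continuous fun t : ℝ => (0 - t) ^ m / (m.factorial : ℝ) := by fun_prop
    exact (hw.continuousOn.smul (hcont n)).aestronglyMeasurable measurableSet_Ioc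
  · exact (ae_restrict_mem measurableSet_Ioc).mono fun t ht =>
      norm_taylor_remainder_le le_rfl ht.1 (hK n t ht)
  · exact (ae_restrict_mem measurableSet_Ioc).mono fun t ht => (hlim (m + 1) t ht).const_smul _

/-- A pointwise limit of uniformly bounded holomorphic functions is holomorphic. -/
theorem differentiableAt_of_tendsto_of_bounded {G : ℕ → ℂ → ℂ} {g : ℂ → ℂ} {c : ℂ} {r B : ℝ}
    (hr : 0 < r) (hG : ∀ n, DifferentiableOn ℂ (G n) (Metric.closedBall c r))
    (hB : ∀ n, ∀ z ∈ Metric.closedBall c r, ‖G n z‖ ≤ B)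
    (hlim : ∀ z ∈ Metric.closedBall c r, Tendsto (fun n => G n z) atTop (nhds (g z))) :
    DifferentiableAt ℂ g c := by
  lift r to NNReal using hr.le
  have hmem (θ : ℝ) : circleMap c r θ ∈ Metric.closedBall c r :=
    circleMap_mem_closedBall c hr.le θ
  have hGc (n : ℕ) : Continuous fun θ => G n (circleMap c r θ) :=
    (hG n).continuousOn.comp_continuous (continuous_circleMap c r) hmem
  have hint : CircleIntegrable g c r := by
    have hmeas : AEStronglyMeasurable (fun θ => g (circleMap c r θ))
        (volume.restrict (Set.uIoc 0 (2 * Real.pi))) :=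
      aestronglyMeasurable_of_tendsto_ae atTop
        (fun n => (hGc n).aestronglyMeasurable)
        (Eventually.of_forall fun θ => hlim _ (hmem θ))
    refine (intervalIntegrable_const (c := B)).mono_fun' hmeas (Eventually.of_forall fun θ => ?_)
    exact le_of_tendsto (hlim _ (hmem θ)).norm (Eventually.of_forall fun n => hB n _ (hmem θ))
  have hpow := hasFPowerSeriesOn_cauchy_integral hint hr
  have heq : ∀ w ∈ Metric.ball c (r : ℝ),
      g w = (2 * Real.pi * I : ℂ)⁻¹ • ∮ z in C(c, r), (z - w)⁻¹ • g z := by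
    intro w hw
    have hd : ∀ θ : ℝ, circleMap c r θ - w ≠ 0 := fun θ =>
      sub_ne_zero.2 (circleMap_ne_mem_ball hw θ)
    have hker : Continuous fun θ : ℝ => (circleMap c r θ - w)⁻¹ :=
      ((continuous_circleMap c r).sub continuous_const).inv₀ hd
    have hderiv : Continuous (deriv (circleMap c r)) := by
      simp only [funext (deriv_circleMap c (r : ℝ))]
      fun_prop
    refine tendsto_nhds_unique (hlim w (Metric.ball_subset_closedBall hw)) ?_
    have hcauchy (n : ℕ) :
        (2 * Real.pi * I : ℂ)⁻¹ • (∮ z in C(c, r), (z - w)⁻¹ • G n z) = G n w :=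
      two_pi_I_inv_smul_circleIntegral_sub_inv_smul_of_differentiable_on_off_countable
        Set.countable_empty hw (hG n).continuousOn fun z hz =>
          (hG n).differentiableAt (Metric.closedBall_mem_nhds_of_mem hz.1)
    refine Tendsto.congr hcauchy (Tendsto.const_smul ?_ _)
    refine intervalIntegral.tendsto_integral_filter_of_dominated_convergence
      (fun θ => ‖deriv (circleMap c r) θ‖ * (‖(circleMap c r θ - w)⁻¹‖ * B)) ?_ ?_ ?_ ?_
    · exact Eventually.of_forall fun n =>
        (hderiv.smul (hker.smul (hGc n))).aestronglyMeasurable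
    · refine Eventually.of_forall fun n => Eventually.of_forall fun θ _ => ?_
      rw [norm_smul, norm_smul]
      gcongr
      exact hB n _ (hmem θ)
    · exact (hderiv.norm.mul (hker.norm.mul continuous_const)).intervalIntegrable _ _
    · exact Eventually.of_forall fun θ _ =>
        ((hlim _ (hmem θ)).const_smul _).const_smul _
  have hda : DifferentiableAt ℂ
      (fun w => (2 * Real.pi * I : ℂ)⁻¹ • ∮ z in C(c, r), (z - w)⁻¹ • g z) c :=
    hpow.analyticAt.differentiableAt
  exact hda.congr_of_eventuallyEq
    (eventually_of_mem (Metric.ball_mem_nhds c hr) heq)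

theorem integrable_of_norm_le_mul_schwartz (f : SchwartzMap ℝ ℂ) (A : ℝ) (N : ℕ) :
    Integrable fun x : ℝ => A * (1 + |x| ^ N) * ‖f x‖ := by
  have h := ((f.integrable_pow_mul volume 0).add (f.integrable_pow_mul volume N)).const_mul A
  refine h.congr (Eventually.of_forall fun x => ?_)
  simp only [Pi.add_apply, pow_zero, Real.norm_eq_abs]
  ring

theorem integrable_mul_schwartz {φ : ℝ → ℂ} (hφ : Continuous φ) {A : ℝ} {N : ℕ}
    (hA : ∀ x, ‖φ x‖ ≤ A * (1 + |x| ^ N)) (f : SchwartzMap ℝ ℂ) :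
    Integrable fun x => φ x * f x := by
  refine (integrable_of_norm_le_mul_schwartz f A N).mono'
    (hφ.mul f.continuous).aestronglyMeasurable (Eventually.of_forall fun x => ?_)
  rw [norm_mul]
  gcongr
  exact hA x

theorem isOpen_strip (a : ℝ) : IsOpen {τ : ℂ | 0 < τ.im ∧ τ.im < a} :=
  (isOpen_lt continuous_const continuous_im).inter (isOpen_lt continuous_im continuous_const)

theorem ofReal_add_ofReal_mul_I_mem_strip {a y : ℝ} (hy : 0 < y) (hya : y < a) (x : ℝ) :
    (x + y * I : ℂ) ∈ {τ : ℂ | 0 < τ.im ∧ τ.im < a} := by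
  simpa using ⟨hy, hya⟩

theorem continuous_comp_horizontal {a y : ℝ} {g : ℂ → ℂ}
    (hg : ContinuousOn g {τ : ℂ | 0 < τ.im ∧ τ.im < a}) (hy : 0 < y) (hya : y < a) :
    Continuous fun x : ℝ => g (x + y * I) :=
  hg.comp_continuous (by fun_prop) (ofReal_add_ofReal_mul_I_mem_strip hy hya)

theorem norm_integral_mul_schwartz_le {a C y : ℝ} {N M : ℕ} {g : ℂ → ℂ}
    (hb : ∀ x y : ℝ, 0 < y → y < a → ‖g (x + y * I)‖ ≤ C * (1 + |x| ^ N) / y ^ M)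
    (hy : 0 < y) (hya : y < a) (f : SchwartzMap ℝ ℂ) :
    ‖∫ x : ℝ, g (x + y * I) * f x‖ ≤ (∫ x : ℝ, C * (1 + |x| ^ N) * ‖f x‖) / y ^ M := by
  rw [← integral_div]
  refine norm_integral_le_of_norm_le ((integrable_of_norm_le_mul_schwartz f C N).div_const _)
    (Eventually.of_forall fun x => ?_)
  rw [norm_mul, mul_div_right_comm]
  gcongr
  exact hb x y hy hya

theorem one_add_add_pow_le {u r : ℝ} (hu : 0 ≤ u) (hr : 0 ≤ r) (N : ℕ) :
    1 + (u + r) ^ N ≤ (1 + 2 ^ (N - 1)) * (1 + r ^ N) * (1 + u ^ N) := by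
  have h := add_pow_le hu hr N
  have h2 : (0 : ℝ) ≤ 2 ^ (N - 1) := by positivity
  have hu' : 0 ≤ u ^ N := by positivity
  have hr' : 0 ≤ r ^ N := by positivity
  nlinarith [mul_nonneg hu' hr', mul_nonneg h2 (mul_nonneg hu' hr')]

/-- A Cauchy estimate: slow growth passes to the derivative, locally uniformly in `Im τ`. -/
theorem exists_norm_deriv_le_of_slowGrowth {a C y : ℝ} {N M : ℕ} {g : ℂ → ℂ} (hC : 0 ≤ C)
    (hg : DifferentiableOn ℂ g {τ : ℂ | 0 < τ.im ∧ τ.im < a})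
    (hb : ∀ x y : ℝ, 0 < y → y < a → ‖g (x + y * I)‖ ≤ C * (1 + |x| ^ N) / y ^ M)
    (hy : 0 < y) (hya : y < a) :
    ∃ r > 0, Metric.ball y r ⊆ Set.Ioo 0 a ∧ ∃ A : ℝ, ∀ t ∈ Metric.ball y r, ∀ x : ℝ,
      ‖deriv g (x + t * I)‖ ≤ A * (1 + |x| ^ N) := by
  obtain ⟨r, hr, hry, hra⟩ : ∃ r > 0, 4 * r ≤ y ∧ 4 * r ≤ a - y :=
    ⟨min y (a - y) / 4, by have := lt_min hy (sub_pos.2 hya); positivity,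
      by linarith [min_le_left y (a - y)], by linarith [min_le_right y (a - y)]⟩
  refine ⟨r, hr, fun t ht => ?_,
    C * ((1 + 2 ^ (N - 1)) * (1 + r ^ N)) / (y / 2) ^ M / r, fun t ht x => ?_⟩
  · rw [Real.ball_eq_Ioo] at ht
    exact ⟨by linarith [ht.1], by linarith [ht.2]⟩
  rw [Real.ball_eq_Ioo] at ht
  have hmem : ∀ z ∈ Metric.closedBall (x + t * I : ℂ) r,
      |z.re| ≤ |x| + r ∧ y / 2 ≤ z.im ∧ z.im < a := by
    intro z hz
    rw [mem_closedBall_iff_norm] at hz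
    have hre := (abs_re_le_norm (z - (x + t * I))).trans hz
    have him := (abs_im_le_norm (z - (x + t * I))).trans hz
    simp only [sub_re, sub_im, add_re, add_im, ofReal_re, ofReal_im, mul_re, mul_im, I_re, I_im,
      mul_zero, mul_one, sub_zero, add_zero, zero_add] at hre him
    rw [abs_le] at him
    refine ⟨?_, by linarith [ht.1], by linarith [ht.2]⟩
    have := abs_add_le x (z.re - x)
    rw [add_sub_cancel] at this
    linarith
  have hd : DifferentiableOn ℂ g (Metric.closedBall (x + t * I : ℂ) r) :=
    hg.mono fun z hz => ⟨by linarith [(hmem z hz).2.1], (hmem z hz).2.2⟩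
  calc ‖deriv g (x + t * I)‖
      ≤ C * ((1 + 2 ^ (N - 1)) * (1 + r ^ N) * (1 + |x| ^ N)) / (y / 2) ^ M / r := by
        refine norm_deriv_le_of_forall_mem_sphere_norm_le hr (hd.diffContOnCl_ball le_rfl)
          fun z hz => ?_
        obtain ⟨h1, h2, h3⟩ := hmem z (Metric.sphere_subset_closedBall hz)
        have h4 := hb z.re z.im (by linarith) h3
        rw [re_add_im] at h4
        refine h4.trans ?_
        gcongr
        refine le_trans ?_ (one_add_add_pow_le (abs_nonneg x) hr.le N)
        gcongr
    _ = _ := by ring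

theorem hasDerivAt_integral_mul_schwartz {a C y : ℝ} {N M : ℕ} {g : ℂ → ℂ} (hC : 0 ≤ C)
    (hg : DifferentiableOn ℂ g {τ : ℂ | 0 < τ.im ∧ τ.im < a})
    (hb : ∀ x y : ℝ, 0 < y → y < a → ‖g (x + y * I)‖ ≤ C * (1 + |x| ^ N) / y ^ M)
    (hy : 0 < y) (hya : y < a) (f : SchwartzMap ℝ ℂ) :
    HasDerivAt (fun y : ℝ => ∫ x : ℝ, g (x + y * I) * f x)
      (-I * ∫ x : ℝ, g (x + y * I) * SchwartzMap.derivCLM ℂ ℂ f x) y := by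
  obtain ⟨r, hr, hra, A, hA⟩ := exists_norm_deriv_le_of_slowGrowth hC hg hb hy hya
  have hgd {t : ℝ} (ht : t ∈ Set.Ioo 0 a) (x : ℝ) :
      HasDerivAt g (deriv g (x + t * I)) (x + t * I) :=
    (hg.differentiableAt ((isOpen_strip a).mem_nhds
      (ofReal_add_ofReal_mul_I_mem_strip ht.1 ht.2 x))).hasDerivAt
  have hgc {t : ℝ} (ht : t ∈ Set.Ioo 0 a) : Continuous fun x : ℝ => g (x + t * I) :=
    continuous_comp_horizontal hg.continuousOn ht.1 ht.2
  have hdc : Continuous fun x : ℝ => deriv g (x + y * I) :=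
    continuous_comp_horizontal (hg.deriv (isOpen_strip a)).continuousOn hy hya
  have hgb (x : ℝ) : ‖g (x + y * I)‖ ≤ C / y ^ M * (1 + |x| ^ N) :=
    (hb x y hy hya).trans_eq (by ring)
  have hdb (x : ℝ) : ‖deriv g (x + y * I)‖ ≤ A * (1 + |x| ^ N) :=
    hA y (Metric.mem_ball_self hr) x
  have hparam := (hasDerivAt_integral_of_dominated_loc_of_deriv_le (μ := volume)
    (F := fun (t x : ℝ) => g (x + t * I) * f x)
    (F' := fun (t x : ℝ) => deriv g (x + t * I) * I * f x)
    (bound := fun x => A * (1 + |x| ^ N) * ‖f x‖)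
    (Metric.ball_mem_nhds y hr)
    (eventually_of_mem (Metric.ball_mem_nhds y hr) fun t ht =>
      ((hgc (hra ht)).mul f.continuous).aestronglyMeasurable)
    (integrable_mul_schwartz (hgc ⟨hy, hya⟩) hgb f)
    ((hdc.mul continuous_const).mul f.continuous).aestronglyMeasurable
    (Eventually.of_forall fun x t ht => by
      rw [norm_mul, norm_mul, norm_I, mul_one]
      gcongr
      exact hA t ht x)
    (integrable_of_norm_le_mul_schwartz f A N)
    (Eventually.of_forall fun x t ht => by
      have hline : HasDerivAt (fun s : ℝ => (x + s * I : ℂ)) I t := by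
        simpa using ((hasDerivAt_id t).ofReal_comp.mul_const I).const_add (x : ℂ)
      exact ((hgd (hra ht) x).comp t hline).mul_const (f x))).2
  have hparts := integral_mul_deriv_eq_deriv_mul_of_integrable
    (u := fun x : ℝ => g (x + y * I)) (u' := fun x : ℝ => deriv g (x + y * I))
    (v := f) (v' := SchwartzMap.derivCLM ℂ ℂ f)
    (fun x _ => by
      have hline : HasDerivAt (fun s : ℝ => (s + y * I : ℂ)) 1 x := by
        simpa using (hasDerivAt_id x).ofReal_comp.add_const (y * I : ℂ)
      have h := (hgd ⟨hy, hya⟩ x).comp x hline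
      rwa [mul_one] at h)
    (fun x _ => by
      rw [SchwartzMap.derivCLM_apply]
      exact f.differentiableAt.hasDerivAt)
    (integrable_mul_schwartz (hgc ⟨hy, hya⟩) hgb _)
    (integrable_mul_schwartz hdc hdb f)
    (integrable_mul_schwartz (hgc ⟨hy, hya⟩) hgb f)
  convert! hparam using 1
  rw [hparts, neg_mul_neg, ← integral_const_mul]
  congr 1
  ext x
  ring

/-- The iterated derivatives in `y` of `∫ g (x + iy) f x`, with all derivatives moved onto `f`. -/
noncomputable def pairingDeriv (g : ℂ → ℂ) (f : SchwartzMap ℝ ℂ) (k : ℕ) (y : ℝ) : ℂ :=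
  (-I) ^ k * ∫ x : ℝ, g (x + y * I) * (SchwartzMap.derivCLM ℂ ℂ)^[k] f x

theorem hasDerivAt_pairingDeriv {a C y : ℝ} {N M : ℕ} {g : ℂ → ℂ} (hC : 0 ≤ C)
    (hg : DifferentiableOn ℂ g {τ : ℂ | 0 < τ.im ∧ τ.im < a})
    (hb : ∀ x y : ℝ, 0 < y → y < a → ‖g (x + y * I)‖ ≤ C * (1 + |x| ^ N) / y ^ M)
    (hy : 0 < y) (hya : y < a) (f : SchwartzMap ℝ ℂ) (k : ℕ) :
    HasDerivAt (pairingDeriv g f k) (pairingDeriv g f (k + 1) y) y := by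
  have h := (hasDerivAt_integral_mul_schwartz hC hg hb hy hya
    ((SchwartzMap.derivCLM ℂ ℂ)^[k] f)).const_mul ((-I) ^ k)
  rw [← mul_assoc, ← pow_succ] at h
  unfold pairingDeriv
  rw [Function.iterate_succ_apply']
  exact h

theorem norm_pairingDeriv_le {a C y : ℝ} {N M : ℕ} {g : ℂ → ℂ}
    (hb : ∀ x y : ℝ, 0 < y → y < a → ‖g (x + y * I)‖ ≤ C * (1 + |x| ^ N) / y ^ M)
    (hy : 0 < y) (hya : y < a) (f : SchwartzMap ℝ ℂ) (k : ℕ) :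
    ‖pairingDeriv g f k y‖ ≤
      (∫ x : ℝ, C * (1 + |x| ^ N) * ‖(SchwartzMap.derivCLM ℂ ℂ)^[k] f x‖) / y ^ M := by
  rw [pairingDeriv, norm_mul, norm_pow, norm_neg, norm_I, one_pow, one_mul]
  exact norm_integral_mul_schwartz_le hb hy hya _

theorem tendsto_pairingDeriv {a C y : ℝ} {N M : ℕ} {G : ℕ → ℂ → ℂ} {g : ℂ → ℂ}
    (hG : ∀ n, DifferentiableOn ℂ (G n) {τ : ℂ | 0 < τ.im ∧ τ.im < a})
    (hb : ∀ n, ∀ x y : ℝ, 0 < y → y < a → ‖G n (x + y * I)‖ ≤ C * (1 + |x| ^ N) / y ^ M)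
    (hlim : ∀ τ : ℂ, 0 < τ.im → τ.im < a → Tendsto (fun n => G n τ) atTop (nhds (g τ)))
    (hy : 0 < y) (hya : y < a) (f : SchwartzMap ℝ ℂ) (k : ℕ) :
    Tendsto (fun n => pairingDeriv (G n) f k y) atTop (nhds (pairingDeriv g f k y)) := by
  refine Tendsto.const_mul _ (tendsto_integral_of_dominated_convergence
    (fun x => C / y ^ M * (1 + |x| ^ N) * ‖(SchwartzMap.derivCLM ℂ ℂ)^[k] f x‖) (fun n => ?_)
    (integrable_of_norm_le_mul_schwartz _ _ N) (fun n => Eventually.of_forall fun x => ?_)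
    (Eventually.of_forall fun x => ?_))
  · exact ((continuous_comp_horizontal (hG n).continuousOn hy hya).mul
      (SchwartzMap.continuous _)).aestronglyMeasurable
  · rw [norm_mul]
    gcongr
    exact (hb n x y hy hya).trans_eq (by ring)
  · obtain ⟨h1, h2⟩ := ofReal_add_ofReal_mul_I_mem_strip hy hya x
    exact (hlim _ h1 h2).mul_const _

/-- **Vladimirov boundary value theorem, convergence part.**
If holomorphic functions `gseq n` on the strip `0 < Im τ < a` satisfy a uniform slow-growth
bound and converge pointwise to `g`, then `g` is holomorphic with the same bound, and the
boundary values converge: for every Schwartz `f`,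
`lim_n [lim_{y→0+} ∫ gseq n (x+iy) f(x) dx] = lim_{y→0+} ∫ g(x+iy) f(x) dx`. -/
theorem boundary_values_converge
    (a : ℝ) (ha : 0 < a)
    (C : ℝ) (hC : 0 < C) (N M : ℕ)
    (gseq : ℕ → ℂ → ℂ) (g : ℂ → ℂ)
    (hgseq : ∀ n, DifferentiableOn ℂ (gseq n) {τ : ℂ | 0 < τ.im ∧ τ.im < a})
    (hbound : ∀ n, ∀ x y : ℝ, 0 < y → y < a →
      ‖gseq n (↑x + ↑y * Complex.I)‖ ≤ C * (1 + |x| ^ N) / y ^ M)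
    (hlim : ∀ τ : ℂ, 0 < τ.im → τ.im < a →
      Tendsto (fun n => gseq n τ) atTop (nhds (g τ))) :
    (DifferentiableOn ℂ g {τ : ℂ | 0 < τ.im ∧ τ.im < a}) ∧
    (∀ x y : ℝ, 0 < y → y < a →
      ‖g (↑x + ↑y * Complex.I)‖ ≤ C * (1 + |x| ^ N) / y ^ M) ∧
    (∀ f : SchwartzMap ℝ ℂ,
      ∃ (ℓ : ℕ → ℂ) (Lim : ℂ),
        (∀ n, Tendsto (fun y : ℝ => ∫ x : ℝ, gseq n (↑x + ↑y * Complex.I) * f x)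
          (nhdsWithin 0 (Set.Ioi 0)) (nhds (ℓ n))) ∧
        Tendsto (fun y : ℝ => ∫ x : ℝ, g (↑x + ↑y * Complex.I) * f x)
          (nhdsWithin 0 (Set.Ioi 0)) (nhds Lim) ∧
        Tendsto ℓ atTop (nhds Lim)) := by
  have hbg : ∀ x y : ℝ, 0 < y → y < a → ‖g (x + y * I)‖ ≤ C * (1 + |x| ^ N) / y ^ M := by
    intro x y hy hya
    obtain ⟨h1, h2⟩ := ofReal_add_ofReal_mul_I_mem_strip hy hya x
    exact le_of_tendsto (hlim _ h1 h2).norm (Eventually.of_forall fun n => hbound n x y hy hya)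
  have hg : DifferentiableOn ℂ g {τ : ℂ | 0 < τ.im ∧ τ.im < a} := by
    intro c hc
    obtain ⟨r, hr, hsub⟩ := Metric.nhds_basis_closedBall.mem_iff.1
      ((isOpen_strip a).mem_nhds hc)
    have hcont : ContinuousOn (fun z : ℂ => C * (1 + |z.re| ^ N) / z.im ^ M)
        (Metric.closedBall c r) := by
      refine ContinuousOn.div (by fun_prop) (by fun_prop) fun z hz => ?_
      exact pow_ne_zero _ (hsub hz).1.ne'
    obtain ⟨B, hB⟩ := (isCompact_closedBall c r).exists_bound_of_continuousOn hcont
    refine (differentiableAt_of_tendsto_of_bounded (B := B) hr (fun n => (hgseq n).mono hsub)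
      (fun n z hz => ?_) fun z hz => hlim z (hsub hz).1 (hsub hz).2).differentiableWithinAt
    have h := hbound n z.re z.im (hsub hz).1 (hsub hz).2
    rw [re_add_im] at h
    exact h.trans ((Real.le_norm_self _).trans (hB z hz))
  refine ⟨hg, hbg, fun f => ?_⟩
  have hb : 0 < a / 2 := half_pos ha
  have hlt {t : ℝ} (ht : t ∈ Set.Ioc 0 (a / 2)) : t < a := by linarith [ht.2]
  have hpair (u : ℂ → ℂ) : pairingDeriv u f 0 = fun y : ℝ => ∫ x : ℝ, u (x + y * I) * f x := by
    ext y
    simp [pairingDeriv]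
  refine ⟨fun n => boundaryValue (pairingDeriv (gseq n) f) M (a / 2),
    boundaryValue (pairingDeriv g f) M (a / 2), fun n => ?_, ?_, ?_⟩
  · rw [← hpair]
    exact tendsto_boundaryValue hb
      (fun t ht k => hasDerivAt_pairingDeriv hC.le (hgseq n) (hbound n) ht.1 (hlt ht) f k)
      (fun t ht => norm_pairingDeriv_le (hbound n) ht.1 (hlt ht) f _)
  · rw [← hpair]
    exact tendsto_boundaryValue hb
      (fun t ht k => hasDerivAt_pairingDeriv hC.le hg hbg ht.1 (hlt ht) f k)
      (fun t ht => norm_pairingDeriv_le hbg ht.1 (hlt ht) f _)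
  · exact tendsto_boundaryValue_of_pointwise hb
      (fun n t ht => (hasDerivAt_pairingDeriv hC.le (hgseq n) (hbound n) ht.1 (hlt ht) f
        _).continuousAt.continuousWithinAt)
      (fun n t ht => norm_pairingDeriv_le (hbound n) ht.1 (hlt ht) f _)
      (fun k t ht => tendsto_pairingDeriv hgseq hbound hlim ht.1 (hlt ht) f k)
end

section
/- Let 𝔻 = {w ∈ ℂ : |w| < 1}, let C > 0 and M ≥ 0, and let (g_n) be a sequence of functions holomorphic on 𝔻 with |g_n(w)| ≤ C (1 - |w|)^{-M} for all w ∈ 𝔻 and all n. Suppose g_n converges pointwise on 𝔻 to g. Then g is holomorphic and satisfies the same bound, and for every smooth 2π-periodic function f : ℝ → ℂ, lim_{n→∞} [lim_{r→1⁻} ∫_0^{2π} g_n(r e^{iθ}) f(θ) dθ] = lim_{r→1⁻} ∫_0^{2π} g(r e^{iθ}) f(θ) dθ, where all the inner limits exist and are finite. -/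
open MeasureTheory Filter Complex Metric

/-- Fourier integrals of a smooth `2π`-periodic function decay faster than any power. -/
theorem exists_norm_integral_exp_mul_pow_le (N : ℕ) :
    ∀ f : ℝ → ℂ, ContDiff ℝ (⊤ : ℕ∞) f → (∀ θ : ℝ, f (θ + 2 * Real.pi) = f θ) →
      ∃ B : ℝ, ∀ k : ℕ, ‖∫ θ in (0 : ℝ)..(2 * Real.pi), exp (θ * I) ^ k * f θ‖
        * ((k : ℝ) + 2) ^ N ≤ B := by
  induction N with
  | zero =>
    intro f hf _
    refine ⟨∫ θ in (0 : ℝ)..(2 * Real.pi), ‖f θ‖, fun k => ?_⟩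
    rw [pow_zero, mul_one]
    refine (intervalIntegral.norm_integral_le_integral_norm (by positivity)).trans_eq ?_
    simp [norm_exp_ofReal_mul_I]
  | succ N ih =>
    intro f hf hper
    have hd : Differentiable ℝ f := hf.differentiable (by simp)
    have hf' : ContDiff ℝ (⊤ : ℕ∞) (deriv f) := (contDiff_infty_iff_deriv.1 hf).2
    obtain ⟨B, hB⟩ := ih f hf hper
    obtain ⟨B', hB'⟩ := ih (deriv f) hf' fun θ => by
      rw [← deriv_comp_add_const]; congr 1; exact funext hper
    refine ⟨B' + 2 * B, fun k => ?_⟩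
    set F := ∫ θ in (0 : ℝ)..(2 * Real.pi), exp (θ * I) ^ k * f θ with hF
    set F' := ∫ θ in (0 : ℝ)..(2 * Real.pi), exp (θ * I) ^ k * deriv f θ with hF'
    have hparts : F' = -(k * I * F) := by
      have he (x : ℝ) : HasDerivAt (fun θ : ℝ => exp (θ * I) ^ k)
          (k * I * exp (x * I) ^ k) x := by
        simp_rw [← Complex.exp_nat_mul]
        have h := (((hasDerivAt_id (x : ℂ)).mul_const I).const_mul (k : ℂ)).cexp.comp_ofReal
        simpa [mul_comm] using h
      have h := intervalIntegral.integral_mul_deriv_eq_deriv_mul (a := 0) (b := 2 * Real.pi)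
        (fun x _ => he x) (fun x _ => (hd x).hasDerivAt)
        (Continuous.intervalIntegrable (by fun_prop) _ _)
        (hf'.continuous.intervalIntegrable _ _)
      have h0 : f (2 * Real.pi) = f 0 := by simpa using hper 0
      rw [hF', h, h0, hF, ← intervalIntegral.integral_const_mul]
      have hexp : exp (2 * (Real.pi * I)) = 1 := by rw [← mul_assoc, exp_two_pi_mul_I]
      simp [mul_assoc, hexp]
    have hn : ‖F'‖ = k * ‖F‖ := by rw [hparts]; simp
    have h1 := hB k
    have h2 := hB' k
    rw [← hF] at h1
    rw [← hF', hn] at h2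
    calc ‖F‖ * ((k : ℝ) + 2) ^ (N + 1)
        = k * ‖F‖ * ((k : ℝ) + 2) ^ N + 2 * (‖F‖ * ((k : ℝ) + 2) ^ N) := by ring
      _ ≤ B' + 2 * B := by linarith

/-- Taylor coefficients at the origin of a holomorphic function of moderate growth on the unit
disk grow at most polynomially. -/
theorem norm_taylorCoeff_le_of_norm_le_div_rpow {C M : ℝ} (hC : 0 < C) {g : ℂ → ℂ}
    (hg : DifferentiableOn ℂ g (ball 0 1))
    (hb : ∀ w ∈ ball (0 : ℂ) 1, ‖g w‖ ≤ C / (1 - ‖w‖) ^ M) (k : ℕ) :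
    ‖(k.factorial : ℂ)⁻¹ * iteratedDeriv k g 0‖ ≤ C * Real.exp 1 * ((k : ℝ) + 2) ^ ⌈M⌉₊ := by
  set R : ℝ := ((k : ℝ) + 1) / (k + 2) with hR
  have hR0 : 0 < R := by positivity
  have hR1 : R < 1 := by rw [hR, div_lt_one (by positivity)]; linarith
  have h1R : 1 - R = ((k : ℝ) + 2)⁻¹ := by rw [hR]; field_simp; ring
  have hsub : closedBall (0 : ℂ) R ⊆ ball 0 1 := closedBall_subset_ball hR1
  have hcauchy := norm_iteratedDeriv_le_of_forall_mem_sphere_norm_le (C := C / (1 - R) ^ M) k hR0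
    ((hg.mono hsub).diffContOnCl_ball subset_rfl) fun z hz => by
      have := hb z (hsub (sphere_subset_closedBall hz))
      rwa [mem_sphere_zero_iff_norm.1 hz] at this
  have hpow : (R ^ k)⁻¹ ≤ Real.exp 1 := by
    have hinv : R⁻¹ = 1 + ((k + 1 : ℕ) : ℝ)⁻¹ := by rw [hR]; push_cast; field_simp; ring
    rw [← inv_pow, hinv]
    refine (pow_le_pow_right₀ ?_ k.le_succ).trans Real.one_add_inv_pow_le_exp
    exact le_add_of_nonneg_right (by positivity)
  have hM' : ((1 - R) ^ M)⁻¹ ≤ ((k : ℝ) + 2) ^ ⌈M⌉₊ := by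
    rw [h1R, Real.inv_rpow (by positivity), inv_inv, ← Real.rpow_natCast]
    exact Real.rpow_le_rpow_of_exponent_le (by linarith [k.cast_nonneg (α := ℝ)]) (Nat.le_ceil M)
  have hk : (0 : ℝ) < k.factorial := by positivity
  rw [norm_mul, norm_inv, Complex.norm_natCast]
  calc (k.factorial : ℝ)⁻¹ * ‖iteratedDeriv k g 0‖
      ≤ (k.factorial : ℝ)⁻¹ * (k.factorial * (C / (1 - R) ^ M) / R ^ k) := by gcongr
    _ = C * (R ^ k)⁻¹ * ((1 - R) ^ M)⁻¹ := by field_simp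
    _ ≤ C * Real.exp 1 * ((k : ℝ) + 2) ^ ⌈M⌉₊ := by
      have : 0 ≤ ((1 - R) ^ M)⁻¹ := inv_nonneg.2 (Real.rpow_nonneg (by linarith) _)
      gcongr

/-- Pairing a holomorphic function on a circle inside the unit disk with a continuous function
amounts to summing the Taylor coefficients against the Fourier integrals. -/
theorem hasSum_integral_circle_mul {g : ℂ → ℂ} (hg : DifferentiableOn ℂ g (ball 0 1))
    {f : ℝ → ℂ} (hf : Continuous f) {r : ℝ} (hr0 : 0 ≤ r) (hr1 : r < 1) :
    HasSum (fun k : ℕ => (k.factorial : ℂ)⁻¹ * iteratedDeriv k g 0 * r ^ k *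
        ∫ θ in (0 : ℝ)..(2 * Real.pi), exp (θ * I) ^ k * f θ)
      (∫ θ in (0 : ℝ)..(2 * Real.pi), g (r * exp (θ * I)) * f θ) := by
  have hsum (z : ℂ) (hz : ‖z‖ < 1) :
      HasSum (fun k : ℕ => (k.factorial : ℂ)⁻¹ * iteratedDeriv k g 0 * z ^ k) (g z) := by
    have h := hasSum_taylorSeries_on_ball hg (mem_ball_zero_iff.2 hz)
    simpa [mul_assoc, mul_comm, mul_left_comm] using h
  have hnorm := (hsum r (by rwa [norm_real, Real.norm_of_nonneg hr0])).summable.norm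
  simp_rw [← intervalIntegral.integral_const_mul]
  refine intervalIntegral.hasSum_integral_of_dominated_convergence
    (fun k θ => ‖(k.factorial : ℂ)⁻¹ * iteratedDeriv k g 0 * (r : ℂ) ^ k‖ * ‖f θ‖)
    (fun k => (Continuous.aestronglyMeasurable (by fun_prop)))
    (fun k => .of_forall fun θ _ => ?_) (.of_forall fun θ _ => hnorm.mul_right _) ?_
    (.of_forall fun θ _ => ?_)
  · simp [norm_exp_ofReal_mul_I]
  · simp_rw [tsum_mul_right]
    exact Continuous.intervalIntegrable (by fun_prop) _ _
  · have h := (hsum (r * exp (θ * I)) (by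
      simpa [norm_exp_ofReal_mul_I, abs_of_nonneg hr0] using hr1)).mul_right (f θ)
    simpa [mul_pow, mul_assoc] using h

/-- Dominated convergence for integrals over a circle of uniformly bounded functions that are
continuous on it. -/
theorem tendsto_circleIntegral_of_norm_le {h : ℕ → ℂ → ℂ} {h' : ℂ → ℂ} {c : ℂ} {R K : ℝ}
    (hR : 0 ≤ R) (hc : ∀ n, ContinuousOn (h n) (sphere c R))
    (hb : ∀ n, ∀ z ∈ sphere c R, ‖h n z‖ ≤ K)
    (hl : ∀ z ∈ sphere c R, Tendsto (fun n => h n z) atTop (nhds (h' z))) :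
    CircleIntegrable h' c R ∧
      Tendsto (fun n => ∮ z in C(c, R), h n z) atTop (nhds (∮ z in C(c, R), h' z)) := by
  have hm (θ : ℝ) : circleMap c R θ ∈ sphere c R := circleMap_mem_sphere c hR θ
  have hcont (n : ℕ) : Continuous fun θ => h n (circleMap c R θ) :=
    (hc n).comp_continuous (continuous_circleMap c R) hm
  constructor
  · have hmeas : Measurable fun θ => h' (circleMap c R θ) :=
      measurable_of_tendsto_metrizable (fun n => (hcont n).measurable)
        (tendsto_pi_nhds.2 fun θ => hl _ (hm θ))
    refine (intervalIntegrable_const (c := K)).mono_fun hmeas.aestronglyMeasurable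
      (.of_forall fun θ => ?_)
    exact (le_of_tendsto (hl _ (hm θ)).norm (.of_forall fun n => hb n _ (hm θ))).trans
      (le_abs_self K)
  · refine intervalIntegral.tendsto_integral_filter_of_dominated_convergence (fun _ => |R| * K)
      (.of_forall fun n => Continuous.aestronglyMeasurable ?_)
      (.of_forall fun n => .of_forall fun θ _ => ?_) intervalIntegrable_const
      (.of_forall fun θ _ => (hl _ (hm θ)).const_smul _)
    · simp only [deriv_circleMap]
      exact ((continuous_circleMap 0 R).mul continuous_const).smul (hcont n)
    · rw [norm_smul]
      simp only [deriv_circleMap, norm_mul, norm_I, mul_one, norm_circleMap_zero]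
      exact mul_le_mul_of_nonneg_left (hb n _ (hm θ)) (abs_nonneg R)

/-- A pointwise limit of holomorphic functions that are uniformly bounded on every circle centred
at the origin is holomorphic. -/
theorem differentiableOn_of_tendsto_of_norm_le {h : ℕ → ℂ → ℂ} {g : ℂ → ℂ} {K : ℝ → ℝ}
    (hh : ∀ n, DifferentiableOn ℂ (h n) (ball 0 1))
    (hb : ∀ n, ∀ w ∈ ball (0 : ℂ) 1, ‖h n w‖ ≤ K ‖w‖)
    (hl : ∀ w ∈ ball (0 : ℂ) 1, Tendsto (fun n => h n w) atTop (nhds (g w))) :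
    DifferentiableOn ℂ g (ball 0 1) := by
  intro w hw
  obtain ⟨R, hwR, hR1⟩ := exists_between (mem_ball_zero_iff.1 hw)
  have hR0 : 0 < R := (norm_nonneg w).trans_lt hwR
  lift R to NNReal using hR0.le
  have hsub : closedBall (0 : ℂ) R ⊆ ball 0 1 := closedBall_subset_ball hR1
  have hsph : sphere (0 : ℂ) R ⊆ ball 0 1 := sphere_subset_closedBall.trans hsub
  have hint : CircleIntegrable g 0 R :=
    (tendsto_circleIntegral_of_norm_le (K := K R) hR0.le
      (fun n => (hh n).continuousOn.mono hsph)
      (fun n z hz => by simpa [mem_sphere_zero_iff_norm.1 hz] using hb n z (hsph hz))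
      (fun z hz => hl z (hsph hz))).1
  have hps := hasFPowerSeriesOn_cauchy_integral hint (by exact_mod_cast hR0)
  have hformula : ∀ u ∈ ball (0 : ℂ) R,
      (2 * Real.pi * I : ℂ)⁻¹ • ∮ z in C(0, R), (z - u)⁻¹ • g z = g u := by
    intro u hu
    have hu' : ‖u‖ < R := mem_ball_zero_iff.1 hu
    have hne (z : ℂ) (hz : z ∈ sphere (0 : ℂ) R) : (R : ℝ) - ‖u‖ ≤ ‖z - u‖ := by
      simpa [mem_sphere_zero_iff_norm.1 hz] using norm_sub_norm_le z u
    have ht := (tendsto_circleIntegral_of_norm_le (K := (R - ‖u‖)⁻¹ * K R)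
      (h := fun n z => (z - u)⁻¹ • h n z) (h' := fun z => (z - u)⁻¹ • g z) (c := 0) hR0.le
      (fun n => ContinuousOn.smul (ContinuousOn.inv₀ (by fun_prop) fun z hz =>
          norm_pos_iff.1 ((sub_pos.2 hu').trans_le (hne z hz)))
        ((hh n).continuousOn.mono hsph))
      (fun n z hz => by
        have h1 := hb n z (hsph hz)
        rw [mem_sphere_zero_iff_norm.1 hz] at h1
        have h2 := hne z hz
        have h3 := sub_pos.2 hu'
        rw [norm_smul, norm_inv]
        gcongr)
      (fun z hz => (hl z (hsph hz)).const_smul _)).2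
    refine tendsto_nhds_unique (ht.const_smul _) ?_
    refine (hl u (hsub (ball_subset_closedBall hu))).congr fun n => ?_
    exact (((hh n).mono hsub).diffContOnCl_ball
      subset_rfl |>.two_pi_i_inv_smul_circleIntegral_sub_inv_smul hu).symm
  have hwR' : w ∈ ball (0 : ℂ) R := mem_ball_zero_iff.2 hwR
  have hd : DifferentiableOn ℂ g (ball 0 R) := by
    have := hps.differentiableOn
    rw [Metric.eball_coe] at this
    exact this.congr fun u hu => (hformula u hu).symm
  exact (hd.differentiableAt (isOpen_ball.mem_nhds hwR')).differentiableWithinAt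

/-- Under pointwise convergence with uniform bounds on circles, derivatives at the origin
converge. -/
theorem tendsto_iteratedDeriv_zero_of_norm_le {h : ℕ → ℂ → ℂ} {g : ℂ → ℂ} {K : ℝ → ℝ}
    (hh : ∀ n, DifferentiableOn ℂ (h n) (ball 0 1))
    (hb : ∀ n, ∀ w ∈ ball (0 : ℂ) 1, ‖h n w‖ ≤ K ‖w‖)
    (hl : ∀ w ∈ ball (0 : ℂ) 1, Tendsto (fun n => h n w) atTop (nhds (g w))) (k : ℕ) :
    Tendsto (fun n => iteratedDeriv k (h n) 0) atTop (nhds (iteratedDeriv k g 0)) := by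
  have hg := differentiableOn_of_tendsto_of_norm_le hh hb hl
  have hR0 : (0 : ℝ) < 1 / 2 := by norm_num
  have hsub : closedBall (0 : ℂ) (1 / 2) ⊆ ball 0 1 := closedBall_subset_ball (by norm_num)
  have hsph : sphere (0 : ℂ) (1 / 2) ⊆ ball 0 1 := sphere_subset_closedBall.trans hsub
  have hz0 (z : ℂ) (hz : z ∈ sphere (0 : ℂ) (1 / 2)) : z - 0 ≠ 0 := by
    rw [sub_zero, ← norm_pos_iff, mem_sphere_zero_iff_norm.1 hz]; exact hR0
  have hformula (u : ℂ → ℂ) (hu : DifferentiableOn ℂ u (ball 0 1)) :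
      (2 * Real.pi * I / k.factorial : ℂ)⁻¹ •
        (∮ z in C(0, 1 / 2), (1 / (z - 0) ^ (k + 1)) • u z) = iteratedDeriv k u 0 := by
    rw [DiffContOnCl.circleIntegral_one_div_sub_center_pow_smul hR0 k
      ((hu.mono hsub).diffContOnCl_ball subset_rfl), inv_smul_smul₀]
    simp [Nat.factorial_ne_zero, Real.pi_ne_zero]
  rw [← hformula g hg]
  simp_rw [← fun n => hformula (h n) (hh n)]
  refine Tendsto.const_smul (tendsto_circleIntegral_of_norm_le
    (K := 1 / (1 / 2) ^ (k + 1) * K (1 / 2)) hR0.le (fun n => ?_) (fun n z hz => ?_)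
    (fun z hz => (hl z (hsph hz)).const_smul _)).2 _
  · exact ContinuousOn.smul (ContinuousOn.div (by fun_prop) (by fun_prop)
      fun z hz => pow_ne_zero _ (hz0 z hz)) ((hh n).continuousOn.mono hsph)
  · have h1 := hb n z (hsph hz)
    have h2 := mem_sphere_zero_iff_norm.1 hz
    rw [h2] at h1
    rw [norm_smul, norm_div, norm_pow, sub_zero, h2, norm_one]
    gcongr

/-- **Distributional convergence on the circle for uniformly bounded holomorphic sequences.**
If each `gseq n` is holomorphic on the unit disk with uniform bound `C (1-|w|)^{-M}` and
`gseq n → g` pointwise, then `g` is holomorphic with the same bound and the boundary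
pairings against smooth `2π`-periodic test functions converge. -/
theorem disk_boundary_values_converge
    (C : ℝ) (hC : 0 < C) (M : ℝ) (hM : 0 ≤ M)
    (gseq : ℕ → ℂ → ℂ) (g : ℂ → ℂ)
    (hgseq : ∀ n, DifferentiableOn ℂ (gseq n) (ball (0 : ℂ) 1))
    (hbound : ∀ n, ∀ w ∈ ball (0 : ℂ) 1, ‖gseq n w‖ ≤ C / (1 - ‖w‖) ^ M)
    (hlim : ∀ w ∈ ball (0 : ℂ) 1, Tendsto (fun n => gseq n w) atTop (nhds (g w))) :
    (DifferentiableOn ℂ g (ball (0 : ℂ) 1)) ∧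
    (∀ w ∈ ball (0 : ℂ) 1, ‖g w‖ ≤ C / (1 - ‖w‖) ^ M) ∧
    (∀ f : ℝ → ℂ, ContDiff ℝ (⊤ : ℕ∞) f → (∀ θ : ℝ, f (θ + 2 * Real.pi) = f θ) →
      ∃ (ℓ : ℕ → ℂ) (Lim : ℂ),
        (∀ n, Tendsto
          (fun r : ℝ => ∫ θ in (0 : ℝ)..(2 * Real.pi),
            gseq n (↑r * Complex.exp (↑θ * Complex.I)) * f θ)
          (nhdsWithin 1 (Set.Iio 1)) (nhds (ℓ n))) ∧
        Tendsto
          (fun r : ℝ => ∫ θ in (0 : ℝ)..(2 * Real.pi),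
            g (↑r * Complex.exp (↑θ * Complex.I)) * f θ)
          (nhdsWithin 1 (Set.Iio 1)) (nhds Lim) ∧
        Tendsto ℓ atTop (nhds Lim)) := by
  have hg := differentiableOn_of_tendsto_of_norm_le (K := fun t => C / (1 - t) ^ M) hgseq hbound hlim
  have hgb : ∀ w ∈ ball (0 : ℂ) 1, ‖g w‖ ≤ C / (1 - ‖w‖) ^ M := fun w hw =>
    le_of_tendsto (hlim w hw).norm (.of_forall fun n => hbound n w hw)
  refine ⟨hg, hgb, fun f hf hper => ?_⟩
  obtain ⟨B, hB⟩ := exists_norm_integral_exp_mul_pow_le (⌈M⌉₊ + 2) f hf hper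
  set F : ℕ → ℂ := fun k => ∫ θ in (0 : ℝ)..(2 * Real.pi), exp (θ * I) ^ k * f θ
  set a : (ℂ → ℂ) → ℕ → ℂ := fun u k => (k.factorial : ℂ)⁻¹ * iteratedDeriv k u 0
  set b : ℕ → ℝ := fun k => C * Real.exp 1 * B * (1 / ((k + 2 : ℕ) : ℝ) ^ 2)
  have hbsum : Summable b :=
    ((summable_nat_add_iff 2).2 (Real.summable_one_div_nat_pow.2 one_lt_two)).mul_left _
  have hdom (u : ℂ → ℂ) (hu : DifferentiableOn ℂ u (ball 0 1))
      (hub : ∀ w ∈ ball (0 : ℂ) 1, ‖u w‖ ≤ C / (1 - ‖w‖) ^ M) (k : ℕ) :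
      ‖a u k * F k‖ ≤ b k := by
    have hFk : ((k : ℝ) + 2) ^ ⌈M⌉₊ * ‖F k‖ ≤ B * (1 / ((k + 2 : ℕ) : ℝ) ^ 2) := by
      push_cast
      rw [mul_one_div, le_div_iff₀ (by positivity)]
      calc _ = ‖F k‖ * ((k : ℝ) + 2) ^ (⌈M⌉₊ + 2) := by ring
        _ ≤ B := hB k
    calc ‖a u k * F k‖ = ‖a u k‖ * ‖F k‖ := norm_mul _ _
      _ ≤ C * Real.exp 1 * ((k : ℝ) + 2) ^ ⌈M⌉₊ * ‖F k‖ := by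
        gcongr; exact norm_taylorCoeff_le_of_norm_le_div_rpow hC hu hub k
      _ = C * Real.exp 1 * (((k : ℝ) + 2) ^ ⌈M⌉₊ * ‖F k‖) := by ring
      _ ≤ C * Real.exp 1 * (B * (1 / ((k + 2 : ℕ) : ℝ) ^ 2)) := by gcongr
      _ = b k := by ring
  have hradial (u : ℂ → ℂ) (hu : DifferentiableOn ℂ u (ball 0 1))
      (hub : ∀ w ∈ ball (0 : ℂ) 1, ‖u w‖ ≤ C / (1 - ‖w‖) ^ M) :
      Tendsto (fun r : ℝ => ∫ θ in (0 : ℝ)..(2 * Real.pi), u (r * exp (θ * I)) * f θ)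
        (nhdsWithin 1 (Set.Iio 1)) (nhds (∑' k, a u k * F k)) := by
    have hr : ∀ᶠ r : ℝ in nhdsWithin 1 (Set.Iio 1), r ∈ Set.Ioo (0 : ℝ) 1 :=
      Ioo_mem_nhdsLT one_pos
    have ht : Tendsto (fun r : ℝ => ∑' k, a u k * (r : ℂ) ^ k * F k)
        (nhdsWithin 1 (Set.Iio 1)) (nhds (∑' k, a u k * F k)) := by
      refine tendsto_tsum_of_dominated_convergence hbsum (fun k => ?_) ?_
      · have hc : Continuous fun r : ℝ => a u k * (r : ℂ) ^ k * F k := by fun_prop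
        simpa using (hc.tendsto 1).mono_left nhdsWithin_le_nhds
      · filter_upwards [hr] with r hr k
        refine le_trans ?_ (hdom u hu hub k)
        rw [mul_right_comm, norm_mul, norm_pow, norm_real, Real.norm_of_nonneg hr.1.le]
        exact mul_le_of_le_one_right (norm_nonneg _) (pow_le_one₀ hr.1.le hr.2.le)
    refine ht.congr' ?_
    filter_upwards [hr] with r hr
    exact (hasSum_integral_circle_mul hu hf.continuous hr.1.le hr.2).tsum_eq
  refine ⟨fun n => ∑' k, a (gseq n) k * F k, ∑' k, a g k * F k,
    fun n => hradial _ (hgseq n) (hbound n), hradial g hg hgb, ?_⟩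
  refine tendsto_tsum_of_dominated_convergence hbsum (fun k => ?_)
    (.of_forall fun n k => hdom _ (hgseq n) (hbound n) k)
  exact ((tendsto_iteratedDeriv_zero_of_norm_le (K := fun t => C / (1 - t) ^ M)
    hgseq hbound hlim k).const_mul _).mul_const _
end
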